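/- Let G1 = (E1, V1, m1) be a weighted graph with V1 countably infinite satisfying (H1) (for every ε > 0 the set {x ∈ V1 : m1(x) ≥ ε} is finite) and (H3) (sup_{x∈V1} deg_{G1}(x) < ∞), and let f : [1,∞) → [1,∞) be continuous, strictly increasing, and tending to +∞ at +∞. Then there exists a weighted graph G̃1 = (Ẽ1, V1, m̃1) such that: (1) Ẽ1(x,y) > 0 if and only if E1(x,y) > 0; (2) G̃1 satisfies (H1) and (H3); (3) deg_{G̃1}(x) ≤ deg_{G1}(x) for all x ∈ V1; (4) |{x ∈ V1 : 1/m̃1(x) ≤ λ}| / f(λ) → 1 as λ → ∞. -/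

import Mathlib

open scoped BigOperators ENNReal

noncomputable section

namespace MagneticCusp

attribute [local instance] Classical.propDecidable

variable {V V1 V2 : Type*}

/-- The axioms of a weighted graph `(E, V, m)`: `E` is symmetric, non-negative,
with no loops, `m` is a positive weight, and the graph is locally finite. -/
def GraphAxioms (E : V → V → ℝ) (m : V → ℝ) : Prop :=
  (∀ x y, E x y = E y x) ∧ (∀ x y, 0 ≤ E x y) ∧ (∀ x, E x x = 0) ∧ (∀ x, 0 < m x) ∧
    ∀ x, {y | 0 < E x y}.Finite

/-- Connectedness of the graph with edge weight `E`. -/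
def Conn (E : V → V → ℝ) : Prop :=
  ∀ x y, Relation.ReflTransGen (fun a b => 0 < E a b) x y

/-- A (real representative of a) magnetic potential: antisymmetric, vanishing off edges. -/
def MagneticPotential (E θ : V → V → ℝ) : Prop :=
  (∀ x y, θ y x = -θ x y) ∧ ∀ x y, E x y = 0 → θ x y = 0

/-- `γ` is a cycle of length `N` in the graph with edge weight `E`. -/
def IsCycle (E : V → V → ℝ) (γ : ℕ → V) (N : ℕ) : Prop :=
  γ N = γ 0 ∧ ∀ i < N, 0 < E (γ i) (γ (i + 1))

/-- The holonomy (flux) of the magnetic potential `θ` along `γ` (a real representative;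
it is to be considered modulo `2π`). -/
def hol (θ : V → V → ℝ) (γ : ℕ → V) (N : ℕ) : ℝ :=
  ∑ i ∈ Finset.range N, θ (γ i) (γ (i + 1))

/-- `Hol_θ = 0`: every cycle has vanishing holonomy in `ℝ/2πℤ`. -/
def HolTrivial (E θ : V → V → ℝ) : Prop :=
  ∀ (γ : ℕ → V) (N : ℕ), IsCycle E γ N → ∃ k : ℤ, hol θ γ N = 2 * Real.pi * k

/-- The magnetic Laplacian `Δ_{G,θ}` acting on functions. -/
def lap (E : V → V → ℝ) (m : V → ℝ) (θ : V → V → ℝ) (f : V → ℂ) (x : V) : ℂ :=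
  ((m x : ℝ) : ℂ)⁻¹ *
    ∑' y, ((E x y : ℝ) : ℂ) * (f x - Complex.exp (((θ x y : ℝ) : ℂ) * Complex.I) * f y)

/-- The magnetic quadratic form `Q_{G,θ}`. -/
def quadForm (E θ : V → V → ℝ) (f : V → ℂ) : ℝ :=
  (1 / 2) * ∑' x, ∑' y, E x y * ‖f x - Complex.exp (((θ x y : ℝ) : ℂ) * Complex.I) * f y‖ ^ 2

/-- The degree `deg_G(x) = m(x)⁻¹ Σ_y E(x,y)`. -/
def degree (E : V → V → ℝ) (m : V → ℝ) (x : V) : ℝ := (m x)⁻¹ * ∑' y, E x y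

/-- The squared norm of `f` in `ℓ²(V,m)`. -/
def nrmSq (m : V → ℝ) (f : V → ℂ) : ℝ := ∑' x, m x * ‖f x‖ ^ 2

/-- Membership in `ℓ²(V,m)`. -/
def MemL2 (m : V → ℝ) (f : V → ℂ) : Prop := Summable fun x => m x * ‖f x‖ ^ 2

/-- The quadratic form `⟨f, deg_G(·) f⟩` of the multiplication operator by the degree. -/
def degForm (E : V → V → ℝ) (m : V → ℝ) (f : V → ℂ) : ℝ :=
  ∑' x, m x * degree E m x * ‖f x‖ ^ 2

/-- Weight of the product of two weighted graphs. -/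
def prodM (m1 : V1 → ℝ) (m2 : V2 → ℝ) : V1 × V2 → ℝ := fun p => m1 p.1 * m2 p.2

/-- Edge weight of the product of `G1` by `G2` through `I ⊆ V2`. -/
def prodE (E1 : V1 → V1 → ℝ) (E2 : V2 → V2 → ℝ) (I : Set V2) :
    V1 × V2 → V1 × V2 → ℝ := fun p q =>
  (if p.2 = q.2 ∧ p.2 ∈ I then E1 p.1 q.1 else 0) + (if p.1 = q.1 then E2 p.2 q.2 else 0)

/-- Edge weight of the Cartesian product of `G1` by `G2`. -/
def cartE (E1 : V1 → V1 → ℝ) (m1 : V1 → ℝ) (E2 : V2 → V2 → ℝ) (m2 : V2 → ℝ) :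
    V1 × V2 → V1 × V2 → ℝ := fun p q =>
  (if p.2 = q.2 then E1 p.1 q.1 * m2 p.2 else 0) + (if p.1 = q.1 then m1 p.1 * E2 p.2 q.2 else 0)

/-- Magnetic potential of the product of `G1` by `G2`. -/
def prodTheta (θ1 : V1 → V1 → ℝ) (θ2 : V2 → V2 → ℝ) : V1 × V2 → V1 × V2 → ℝ := fun p q =>
  (if p.2 = q.2 then θ1 p.1 q.1 else 0) + (if p.1 = q.1 then θ2 p.2 q.2 else 0)

/-- Hypothesis (H1): `m1(x) → 0` as `x → ∞` (on an infinite vertex set). -/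
def H1cond (m1 : V1 → ℝ) : Prop :=
  Infinite V1 ∧ ∀ ε : ℝ, 0 < ε → {x : V1 | ε ≤ m1 x}.Finite

/-- Hypothesis (H3): the degree of `G1` is bounded. -/
def H3cond (E1 : V1 → V1 → ℝ) (m1 : V1 → ℝ) : Prop :=
  ∃ d : ℝ, ∀ x, degree E1 m1 x ≤ d

/-- The quadratic form of the operator `m1⁻¹(·) ⊗ Δ_{G2,θ2}` on `ℓ²(V1 × V2, m1 ⊗ m2)`:
`⟨f, (m1⁻¹(·) ⊗ Δ_{G2,θ2}) f⟩ = Σ_x Q_{G2,θ2}(f(x,·))`. -/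
def fiberForm (E2 θ2 : V2 → V2 → ℝ) (f : V1 × V2 → ℂ) : ℝ :=
  ∑' x : V1, quadForm E2 θ2 fun y => f (x, y)

/-- A simple cycle: closed walk of length `≥ 3` with pairwise distinct vertices. -/
def IsSimpleCycle (E : V → V → ℝ) (γ : ℕ → V) (N : ℕ) : Prop :=
  3 ≤ N ∧ γ N = γ 0 ∧ (∀ i < N, 0 < E (γ i) (γ (i + 1))) ∧
    ∀ i < N, ∀ j < N, γ i = γ j → i = j

/-- The weighted length of an edge, `L_G(x,y) = sqrt(min(m x, m y)/E x y)`. -/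
def edgeLength (E : V → V → ℝ) (m : V → ℝ) (x y : V) : ℝ :=
  Real.sqrt (min (m x) (m y) / E x y)

/-- The weighted length of a cycle. -/
def cycleLength (E : V → V → ℝ) (m : V → ℝ) (γ : ℕ → V) (N : ℕ) : ℝ :=
  ∑ i ∈ Finset.range N, edgeLength E m (γ i) (γ (i + 1))

/-- The (weighted) girth: infimum of the weighted lengths of simple cycles (`∞` if none). -/
def girth (E : V → V → ℝ) (m : V → ℝ) : ℝ≥0∞ :=
  ⨅ c : {c : (ℕ → V) × ℕ // IsSimpleCycle E c.1 c.2},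
    ENNReal.ofReal (cycleLength E m c.1.1 c.1.2)

/-- The radius of injectivity: half the girth. -/
def injRad (E : V → V → ℝ) (m : V → ℝ) : ℝ≥0∞ := girth E m / 2

/-- Min-max encoding: there is an `n`-dimensional subspace of finitely supported
functions (the form core) on which `Q ≤ lam ‖·‖²_{ℓ²(V,m)}`.  For the self-adjoint
operator associated to the form `Q` with form core `C_c(V)` this says
`N_lam(H) = dim ran 1_{(-∞,lam]}(H) ≥ n`. -/
def DimGE (Q : (V → ℂ) → ℝ) (m : V → ℝ) (lam : ℝ) (n : ℕ) : Prop :=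
  ∃ g : Fin n → V → ℂ, LinearIndependent ℂ g ∧
    (∀ i, (Function.support (g i)).Finite) ∧
    ∀ f ∈ Submodule.span ℂ (Set.range g), Q f ≤ lam * nrmSq m f

/-- Compact resolvent (equivalently: empty essential spectrum) of the non-negative
self-adjoint operator associated to the form `Q`, encoded via min-max:
`N_lam(H) < ∞` for every `lam`. -/
def CompactResolvent (Q : (V → ℂ) → ℝ) (m : V → ℝ) : Prop :=
  ∀ lam : ℝ, ∃ n : ℕ, ∀ k : ℕ, DimGE Q m lam k → k ≤ n

/-- The eigenvalue counting function `N_lam(H) = dim ran 1_{(-∞,lam]}(H)`,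
encoded via min-max over the form core. -/
def countEig (Q : (V → ℂ) → ℝ) (m : V → ℝ) (lam : ℝ) : ℕ :=
  sSup {k : ℕ | DimGE Q m lam k}

/-- The `n`-th eigenvalue (counted with multiplicity, `n` starting at `0`) of the
self-adjoint operator associated to `Q`, via the Courant min-max principle. -/
def eigVal (Q : (V → ℂ) → ℝ) (m : V → ℝ) (n : ℕ) : ℝ :=
  sInf {t : ℝ | DimGE Q m t (n + 1)}

/-- Equality of the form domains of the two non-negative forms `Q1`, `Q2`, both with
form core the finitely supported functions: by the closed graph theorem this is
equivalent to the equivalence of the form norms on the common core. -/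
def SameFormDomain (Q1 Q2 : (V → ℂ) → ℝ) (m : V → ℝ) : Prop :=
  ∃ c1 c2 : ℝ, 0 < c1 ∧ 0 < c2 ∧ ∀ f : V → ℂ, (Function.support f).Finite →
    c1 * (nrmSq m f + Q1 f) ≤ nrmSq m f + Q2 f ∧
      nrmSq m f + Q2 f ≤ c2 * (nrmSq m f + Q1 f)


/-- Generalized inverse on `ℕ` of a continuous strictly increasing function tending to `+∞`. -/
theorem exists_le_iff_natCast_le {f : ℝ → ℝ}
    (hf_cont : ContinuousOn f (Set.Ici (1 : ℝ)))
    (hf_mono : StrictMonoOn f (Set.Ici (1 : ℝ)))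
    (hf_top : Filter.Tendsto f Filter.atTop Filter.atTop) (n : ℕ) :
    ∃ t : ℝ, 1 ≤ t ∧ ∀ lam : ℝ, 1 ≤ lam → (t ≤ lam ↔ (n : ℝ) ≤ f lam) := by
  rcases le_total (n : ℝ) (f 1) with h | h
  · refine ⟨1, le_rfl, fun lam hlam => iff_of_true hlam (h.trans ?_)⟩
    exact hf_mono.monotoneOn Set.self_mem_Ici hlam hlam
  · obtain ⟨b, hb, hb1⟩ :=
      ((hf_top.eventually_ge_atTop (n : ℝ)).and (Filter.eventually_ge_atTop 1)).exists
    obtain ⟨t, ht, hft⟩ :=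
      intermediate_value_Icc hb1 (hf_cont.mono Set.Icc_subset_Ici_self) ⟨h, hb⟩
    exact ⟨t, ht.1, fun lam hlam => by rw [← hft, hf_mono.le_iff_le ht.1 hlam]⟩

theorem ncard_natCast_le {a : ℝ} (ha : 0 ≤ a) :
    {n : ℕ | (n : ℝ) ≤ a}.ncard = ⌊a⌋₊ + 1 := by
  have h : {n : ℕ | (n : ℝ) ≤ a} = (Finset.range (⌊a⌋₊ + 1) : Set ℕ) := by
    ext n
    simp [Nat.le_floor_iff ha]
  rw [h, Set.ncard_coe_finset, Finset.card_range]

theorem finite_natCast_le (a : ℝ) : {n : ℕ | (n : ℝ) ≤ a}.Finite :=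
  (Set.finite_Iic ⌊a⌋₊).subset fun _ hn => Nat.le_floor hn

theorem tendsto_floor_add_one_div :
    Filter.Tendsto (fun x : ℝ => ((⌊x⌋₊ + 1 : ℕ) : ℝ) / x) Filter.atTop (nhds 1) := by
  have h := (tendsto_nat_floor_div_atTop (R := ℝ)).add
    (tendsto_inv_atTop_zero (𝕜 := ℝ))
  rw [add_zero] at h
  refine h.congr fun x => ?_
  push_cast
  rw [add_div, one_div]

/-- The edge weight obtained from `E` by changing the vertex weight from `m` to `m'`, rescaled by
the smaller of the two ratios `m' / m` at the endpoints. -/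
def rescaledE (E : V → V → ℝ) (m m' : V → ℝ) : V → V → ℝ :=
  fun x y => min (m' x / m x) (m' y / m y) * E x y

section Rescaled

variable {E : V → V → ℝ} {m m' : V → ℝ}

theorem rescaledE_pos_iff (hm : ∀ x, 0 < m x) (hm' : ∀ x, 0 < m' x) (x y : V) :
    0 < rescaledE E m m' x y ↔ 0 < E x y :=
  mul_pos_iff_of_pos_left (lt_min (div_pos (hm' x) (hm x)) (div_pos (hm' y) (hm y)))

theorem graphAxioms_rescaledE (hG : GraphAxioms E m) (hm' : ∀ x, 0 < m' x) :
    GraphAxioms (rescaledE E m m') m' := by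
  obtain ⟨hsymm, hnonneg, hloop, hm, hfin⟩ := hG
  refine ⟨fun x y => ?_, fun x y => ?_, fun x => ?_, hm', fun x => ?_⟩
  · simp only [rescaledE, hsymm x y, min_comm]
  · exact mul_nonneg
      (le_min (div_pos (hm' x) (hm x)).le (div_pos (hm' y) (hm y)).le) (hnonneg x y)
  · simp only [rescaledE, hloop, mul_zero]
  · simpa only [rescaledE_pos_iff hm hm'] using hfin x

theorem GraphAxioms.summable (hG : GraphAxioms E m) (x : V) : Summable (E x) := by
  obtain ⟨-, hnonneg, -, -, hfin⟩ := hG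
  exact summable_of_hasFiniteSupport
    ((hfin x).subset fun y hy => (hnonneg x y).lt_of_ne' hy)

theorem degree_rescaledE_le (hG : GraphAxioms E m) (hm' : ∀ x, 0 < m' x) (x : V) :
    degree (rescaledE E m m') m' x ≤ degree E m x := by
  have hm := hG.2.2.2.1 x
  have hle : ∑' y, rescaledE E m m' x y ≤ m' x / m x * ∑' y, E x y := by
    rw [← tsum_mul_left]
    exact (GraphAxioms.summable (graphAxioms_rescaledE hG hm') x).tsum_le_tsum
      (fun y => mul_le_mul_of_nonneg_right (min_le_left _ _) (hG.2.1 x y))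
      ((hG.summable x).mul_left _)
  calc degree (rescaledE E m m') m' x
      ≤ (m' x)⁻¹ * (m' x / m x * ∑' y, E x y) :=
        mul_le_mul_of_nonneg_left hle (inv_pos.2 (hm' x)).le
    _ = degree E m x := by
        have := (hm' x).ne'
        have := hm.ne'
        unfold degree
        field_simp

end Rescaled

/-- Given a graph `G1` satisfying (H1) and (H3) on a countably
infinite vertex set and a continuous strictly increasing `f : [1,∞) → [1,∞)` tending
to `+∞`, one can modify the weights of `G1` (same edges, smaller degree, (H1) and (H3)
preserved) so that `|{x : 1/m̃1(x) ≤ λ}| ∼ f(λ)` as `λ → ∞`. -/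
theorem weight_modification_with_prescribed_counting
    [Countable V1] [Infinite V1]
    (E1 : V1 → V1 → ℝ) (m1 : V1 → ℝ)
    (hG1 : GraphAxioms E1 m1) (hconn1 : Conn E1)
    (hH1 : ∀ ε : ℝ, 0 < ε → {x : V1 | ε ≤ m1 x}.Finite)
    (hH3 : H3cond E1 m1)
    (f : ℝ → ℝ)
    (hf_maps : ∀ t ∈ Set.Ici (1 : ℝ), 1 ≤ f t)
    (hf_cont : ContinuousOn f (Set.Ici (1 : ℝ)))
    (hf_mono : StrictMonoOn f (Set.Ici (1 : ℝ)))
    (hf_top : Filter.Tendsto f Filter.atTop Filter.atTop) :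
    ∃ (Et : V1 → V1 → ℝ) (mt : V1 → ℝ),
      GraphAxioms Et mt ∧
      (∀ x y, 0 < Et x y ↔ 0 < E1 x y) ∧
      (∀ ε : ℝ, 0 < ε → {x : V1 | ε ≤ mt x}.Finite) ∧
      H3cond Et mt ∧
      (∀ x, degree Et mt x ≤ degree E1 m1 x) ∧
      Filter.Tendsto (fun lam : ℝ =>
          ({x : V1 | (mt x)⁻¹ ≤ lam}.ncard : ℝ) / f lam)
        Filter.atTop (nhds 1) := by
  obtain ⟨_⟩ := nonempty_denumerable V1
  let e : V1 ≃ ℕ := Denumerable.eqv V1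
  choose l hl hle using exists_le_iff_natCast_le hf_cont hf_mono hf_top
  have hset : ∀ lam : ℝ, 1 ≤ lam → {x : V1 | l (e x) ≤ lam} = e ⁻¹' {n | (n : ℝ) ≤ f lam} :=
    fun lam hlam => Set.ext fun x => hle (e x) lam hlam
  have hmt : ∀ x, 0 < (l (e x))⁻¹ := fun x => inv_pos.2 (one_pos.trans_le (hl _))
  refine ⟨rescaledE E1 m1 fun x => (l (e x))⁻¹, fun x => (l (e x))⁻¹,
    graphAxioms_rescaledE hG1 hmt, rescaledE_pos_iff hG1.2.2.2.1 hmt, fun ε hε => ?_, ?_,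
    degree_rescaledE_le hG1 hmt, ?_⟩
  · have hfin : {x : V1 | l (e x) ≤ max 1 ε⁻¹}.Finite := by
      rw [hset _ (le_max_left _ _)]
      exact (finite_natCast_le _).preimage e.injective.injOn
    refine hfin.subset fun x hx => ?_
    exact le_max_of_le_right ((le_inv_comm₀ hε (one_pos.trans_le (hl _))).1 hx)
  · obtain ⟨d, hd⟩ := hH3
    exact ⟨d, fun x => (degree_rescaledE_le hG1 hmt x).trans (hd x)⟩
  · refine (tendsto_floor_add_one_div.comp hf_top).congr' ?_
    filter_upwards [Filter.eventually_ge_atTop 1] with lam hlam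
    simp only [inv_inv, Function.comp_apply]
    rw [hset lam hlam, Set.ncard_preimage_of_injective_subset_range e.injective (by simp),
      ncard_natCast_le (zero_le_one.trans (hf_maps lam hlam))]

end MagneticCusp
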